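/- Let U be a finite set of Boolean variables and C a collection of clauses over U with exactly three literals per clause, and let Σ, a, b be produced by the reduction construction of Theorem 2 (truth-setting variable blocks, boundary symbol, clause blocks x^i y^i z^i x̄^i ȳ^i z̄^i in a versus x^i y^i z^i ȳ^i x̄^i z̄^i ȳ^i in b). Then every symbol of Σ occurs at most twice in the string a. -/

import Mathlib

namespace CommonPerm

/-! ## The reduction from 3SAT to Common Permutation -/

/-- A literal over variables `Fin m`: a variable together with a sign
(`true` = positive literal `u`, `false` = negated literal `¬u`). -/
abbrev Lit (m : ℕ) := Fin m × Bool

/-- A 3-clause: an (ordered) triple of literals `(x, y, z)`. -/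
abbrev Clause (m : ℕ) := Lit m × Lit m × Lit m

/-- The symbols of the alphabet `Σ`: `none` is the boundary symbol `•`, and
`some (u, i, true)` (resp. `some (u, i, false)`) is the symbol `u^i` (resp. `ū^i`). -/
abbrev Symb (m n : ℕ) := Option (Fin m × Fin n × Bool)

/-- The variable `u` occurs (positively or negatively) in clause `C i`. -/
abbrev OccursIn {m n : ℕ} (C : Fin n → Clause m) (u : Fin m) (i : Fin n) : Prop :=
  (C i).1.1 = u ∨ (C i).2.1.1 = u ∨ (C i).2.2.1 = u

/-- Membership in the alphabet `Σ`: the boundary symbol, together with `u^i`, `ū^i`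
for every variable `u` and every clause `c_i` in which `u` appears. -/
def InSigma {m n : ℕ} (C : Fin n → Clause m) : Symb m n → Prop
  | none => True
  | some (u, i, _) => OccursIn C u i

instance {m n : ℕ} (C : Fin n → Clause m) : DecidablePred (InSigma C) := fun s =>
  match s with
  | none => .isTrue trivial
  | some (_, _, _) => inferInstanceAs (Decidable (_ ∨ _ ∨ _))

/-- The indices `i₁ < ⋯ < i_m` of the clauses in which the variable `u` appears. -/
def clausesOf {m n : ℕ} (C : Fin n → Clause m) (u : Fin m) : List (Fin n) :=
  (List.finRange n).filter fun i => decide (OccursIn C u i)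

/-- The truth-setting block of the string `a` for the variable `u`:
`u^{i₁} ⋯ u^{i_m} ū^{i₁} ⋯ ū^{i_m}`. -/
def vblockA {m n : ℕ} (C : Fin n → Clause m) (u : Fin m) : List (Symb m n) :=
  ((clausesOf C u).map fun i => some (u, i, true)) ++
    ((clausesOf C u).map fun i => some (u, i, false))

/-- The truth-setting block of the string `b` for the variable `u`:
`ū^{i₁} ⋯ ū^{i_m} u^{i₁} ⋯ u^{i_m}`. -/
def vblockB {m n : ℕ} (C : Fin n → Clause m) (u : Fin m) : List (Symb m n) :=
  ((clausesOf C u).map fun i => some (u, i, false)) ++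
    ((clausesOf C u).map fun i => some (u, i, true))

/-- For a literal `x` of clause `c_i`, the symbol `x^i` (i.e. `u^i` if `x = u`
is positive, and `ū^i` if `x = ¬u`). -/
def litSym {m n : ℕ} (i : Fin n) (l : Lit m) : Symb m n := some (l.1, i, l.2)

/-- For a literal `x` of clause `c_i`, the symbol `x̄^i` (i.e. `ū^i` if `x = u`
is positive, and `u^i` if `x = ¬u`). -/
def litSymBar {m n : ℕ} (i : Fin n) (l : Lit m) : Symb m n := some (l.1, i, !l.2)

/-- The satisfaction-testing block of `a` for clause `c_i = {x, y, z}`: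
`x^i y^i z^i x̄^i ȳ^i z̄^i`. -/
def cblockA {m n : ℕ} (C : Fin n → Clause m) (i : Fin n) : List (Symb m n) :=
  [litSym i (C i).1, litSym i (C i).2.1, litSym i (C i).2.2,
   litSymBar i (C i).1, litSymBar i (C i).2.1, litSymBar i (C i).2.2]

/-- The satisfaction-testing block of `b` for clause `c_i = {x, y, z}`:
`x^i y^i z^i ȳ^i x̄^i z̄^i ȳ^i`. -/
def cblockB {m n : ℕ} (C : Fin n → Clause m) (i : Fin n) : List (Symb m n) :=
  [litSym i (C i).1, litSym i (C i).2.1, litSym i (C i).2.2,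
   litSymBar i (C i).2.1, litSymBar i (C i).1, litSymBar i (C i).2.2,
   litSymBar i (C i).2.1]

/-- The truth-setting part of the string `a`. -/
def truthA {m n : ℕ} (C : Fin n → Clause m) : List (Symb m n) :=
  ((List.finRange m).map (vblockA C)).flatten

/-- The truth-setting part of the string `b`. -/
def truthB {m n : ℕ} (C : Fin n → Clause m) : List (Symb m n) :=
  ((List.finRange m).map (vblockB C)).flatten

/-- The satisfaction-testing part of the string `a`. -/
def testA {m n : ℕ} (C : Fin n → Clause m) : List (Symb m n) :=
  ((List.finRange n).map (cblockA C)).flatten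

/-- The satisfaction-testing part of the string `b`. -/
def testB {m n : ℕ} (C : Fin n → Clause m) : List (Symb m n) :=
  ((List.finRange n).map (cblockB C)).flatten

/-- The string `a` of the reduction. -/
def strA {m n : ℕ} (C : Fin n → Clause m) : List (Symb m n) :=
  truthA C ++ [none] ++ testA C

/-- The string `b` of the reduction. -/
def strB {m n : ℕ} (C : Fin n → Clause m) : List (Symb m n) :=
  truthB C ++ [none] ++ testB C

/-- The three literals of each clause involve three pairwise distinct variables
(`c_i` is a set of exactly three literals). -/
def ThreeDistinct {m n : ℕ} (C : Fin n → Clause m) : Prop :=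
  ∀ i, (C i).1.1 ≠ (C i).2.1.1 ∧ (C i).1.1 ≠ (C i).2.2.1 ∧ (C i).2.1.1 ≠ (C i).2.2.1

/-- The literal `l` is true under the truth assignment `t`. -/
def LitTrue {m : ℕ} (t : Fin m → Bool) (l : Lit m) : Prop := t l.1 = l.2

/-- The truth assignment `t` satisfies every clause of `C`. -/
def Satisfies {m n : ℕ} (t : Fin m → Bool) (C : Fin n → Clause m) : Prop :=
  ∀ i, LitTrue t (C i).1 ∨ LitTrue t (C i).2.1 ∨ LitTrue t (C i).2.2

/-- `p` is a permutation of the alphabet `Σ`: a string containing every symbol of `Σ`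
exactly once. -/
def IsPermOfSigma {m n : ℕ} (C : Fin n → Clause m) (p : List (Symb m n)) : Prop :=
  p.Nodup ∧ ∀ s, s ∈ p ↔ InSigma C s

lemma mem_vblockA {m n : ℕ} {C : Fin n → Clause m} {u : Fin m} {s : Symb m n}
    (hs : s ∈ vblockA C u) : ∃ i c, s = some (u, i, c) := by
  simp only [vblockA, List.mem_append, List.mem_map] at hs
  obtain ⟨i, -, rfl⟩ | ⟨i, -, rfl⟩ := hs <;> exact ⟨_, _, rfl⟩

lemma mem_cblockA {m n : ℕ} {C : Fin n → Clause m} {i : Fin n} {s : Symb m n}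
    (hs : s ∈ cblockA C i) : ∃ u c, s = some (u, i, c) := by
  simp only [cblockA, List.mem_cons, List.not_mem_nil, or_false, litSym, litSymBar] at hs
  rcases hs with rfl | rfl | rfl | rfl | rfl | rfl <;> exact ⟨_, _, rfl⟩

lemma nodup_clausesOf {m n : ℕ} (C : Fin n → Clause m) (u : Fin m) : (clausesOf C u).Nodup :=
  (List.nodup_finRange n).filter _

lemma nodup_vblockA {m n : ℕ} (C : Fin n → Clause m) (u : Fin m) : (vblockA C u).Nodup := by
  refine List.Nodup.append ((nodup_clausesOf C u).map ?_) ((nodup_clausesOf C u).map ?_) ?_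
  · intro i j h
    simpa using h
  · intro i j h
    simpa using h
  · simp [List.disjoint_left]

lemma nodup_cblockA {m n : ℕ} {C : Fin n → Clause m} (hC : ThreeDistinct C) (i : Fin n) :
    (cblockA C i).Nodup := by
  obtain ⟨hxy, hxz, hyz⟩ := hC i
  simp [cblockA, litSym, litSymBar, hxy, hxz, hyz, hxy.symm, hxz.symm, hyz.symm]

lemma nodup_truthA {m n : ℕ} (C : Fin n → Clause m) : (truthA C).Nodup := by
  refine List.nodup_flatten.2 ⟨?_, ?_⟩
  · simp [nodup_vblockA]
  · refine List.pairwise_map.2 ((List.nodup_finRange m).imp fun huv s hu hv => ?_)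
    obtain ⟨i, c, rfl⟩ := mem_vblockA hu
    obtain ⟨j, d, h⟩ := mem_vblockA hv
    simp_all

lemma nodup_testA {m n : ℕ} {C : Fin n → Clause m} (hC : ThreeDistinct C) :
    (testA C).Nodup := by
  refine List.nodup_flatten.2 ⟨?_, ?_⟩
  · simp [nodup_cblockA hC]
  · refine List.pairwise_map.2 ((List.nodup_finRange n).imp fun hij s hi hj => ?_)
    obtain ⟨u, c, rfl⟩ := mem_cblockA hi
    obtain ⟨v, d, h⟩ := mem_cblockA hj
    simp_all

lemma none_notMem_truthA {m n : ℕ} (C : Fin n → Clause m) : none ∉ truthA C := by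
  intro h
  simp only [truthA, List.mem_flatten, List.mem_map] at h
  obtain ⟨_, ⟨u, -, rfl⟩, hs⟩ := h
  obtain ⟨i, c, h⟩ := mem_vblockA hs
  simp at h

/-- In the reduction of Theorem 2, every symbol of `Σ` occurs at most
twice in the string `a`. -/
theorem every_symbol_at_most_twice_in_a (m n : ℕ) (C : Fin n → Clause m)
    (hC : ThreeDistinct C) :
    ∀ s : Symb m n, InSigma C s → (strA C).count s ≤ 2 := by
  intro s _
  have htruth := List.nodup_iff_count_le_one.1 (nodup_truthA C) s
  have htest := List.nodup_iff_count_le_one.1 (nodup_testA hC) s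
  rw [strA, List.count_append, List.count_append]
  cases s with
  | none =>
    rw [List.count_eq_zero_of_not_mem (none_notMem_truthA C), List.count_singleton_self]
    omega
  | some s =>
    rw [List.count_eq_zero_of_not_mem (l := [none]) (by simp)]
    omega

end CommonPerm
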